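/- arXiv:2207.08555 — 3 statements merged into one kernel-verified Lean document; each statement's English description precedes it below -/
import Mathlib

section
/- The function ε ↦ ∫_ℝ exp(−φ²/2 − εφ⁴/4) dφ, defined by an absolutely convergent complex-valued Lebesgue integral, is complex differentiable (analytic) at every point of the open half-plane {ε ∈ ℂ : Re ε > 0}. -/
open MeasureTheory

lemma norm_cexp_neg_sq_sub_mul_pow_four_le {z : ℂ} (hz : 0 ≤ z.re) (x : ℝ) :
    ‖Complex.exp (-(x : ℂ) ^ 2 / 2 - z * (x : ℂ) ^ 4 / 4)‖ ≤ Real.exp (-(1 / 2) * x ^ 2) := by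
  have h : (-(x : ℂ) ^ 2 / 2 - z * (x : ℂ) ^ 4 / 4).re = -x ^ 2 / 2 - z.re * x ^ 4 / 4 := by
    have h₁ : -(x : ℂ) ^ 2 / 2 = ((-x ^ 2 / 2 : ℝ) : ℂ) := by push_cast; ring
    have h₂ : z * (x : ℂ) ^ 4 / 4 = ((x ^ 4 / 4 : ℝ) : ℂ) * z := by push_cast; ring
    rw [h₁, h₂, Complex.sub_re, Complex.ofReal_re, Complex.re_ofReal_mul]
    ring
  rw [Complex.norm_exp, h]
  have : 0 ≤ z.re * x ^ 4 := by positivity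
  gcongr
  linarith

/-- The function `ε ↦ ∫_ℝ exp(−φ²/2 − εφ⁴/4) dφ` is complex differentiable (analytic)
at every point of the open half-plane `{ε ∈ ℂ : Re ε > 0}`. -/
theorem stmt2 (ε : ℂ) (hε : 0 < ε.re) :
    DifferentiableAt ℂ
      (fun z : ℂ => ∫ φ : ℝ, Complex.exp (-(φ : ℂ) ^ 2 / 2 - z * (φ : ℂ) ^ 4 / 4)) ε := by
  have hs : {z : ℂ | 0 < z.re} ∈ nhds ε :=
    (isOpen_lt continuous_const Complex.continuous_re).mem_nhds hε
  refine (hasDerivAt_integral_of_dominated_loc_of_deriv_le (μ := volume)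
    (F' := fun (z : ℂ) (φ : ℝ) =>
      Complex.exp (-(φ : ℂ) ^ 2 / 2 - z * (φ : ℂ) ^ 4 / 4) * (-((φ : ℂ) ^ 4 / 4)))
    (bound := fun φ : ℝ => φ ^ 4 * Real.exp (-(1 / 2) * φ ^ 2))
    hs ?_ ?_ ?_ ?_ ?_ ?_).2.differentiableAt
  · exact .of_forall fun z => Continuous.aestronglyMeasurable (by fun_prop)
  · exact (integrable_exp_neg_mul_sq one_half_pos).mono'
      (Continuous.aestronglyMeasurable (by fun_prop))
      (.of_forall (norm_cexp_neg_sq_sub_mul_pow_four_le hε.le))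
  · exact Continuous.aestronglyMeasurable (by fun_prop)
  · refine .of_forall fun φ z hz => ?_
    have h : ‖-((φ : ℂ) ^ 4 / 4)‖ ≤ φ ^ 4 := by
      have h₄ : 0 ≤ φ ^ 4 := by positivity
      have : -((φ : ℂ) ^ 4 / 4) = ((-(φ ^ 4 / 4) : ℝ) : ℂ) := by push_cast; ring
      rw [this, Complex.norm_real, norm_neg, Real.norm_of_nonneg (by positivity)]
      linarith
    rw [norm_mul, mul_comm]
    exact mul_le_mul h (norm_cexp_neg_sq_sub_mul_pow_four_le (le_of_lt hz) φ)
      (norm_nonneg _) (by positivity)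
  · have := integrable_rpow_mul_exp_neg_mul_sq (one_half_pos (α := ℝ)) (s := (4 : ℕ)) (by norm_num)
    simpa only [Real.rpow_natCast] using this
  · refine .of_forall fun φ z _ => HasDerivAt.cexp ?_
    simpa using (((hasDerivAt_id z).mul_const ((φ : ℂ) ^ 4)).div_const 4).const_sub
      (-(φ : ℂ) ^ 2 / 2)
end

section
/- The Borel-transform coefficients of the zero-dimensional Φ⁴ partition function satisfy the asymptotics lim_{n→∞} n · Γ(n + 1/4) · Γ(n + 3/4) / Γ(n + 1)² = 1; that is, b_n := (−4)^n Γ(n + 1/4) Γ(n + 3/4) / Γ(n + 1)² satisfies b_n = ((−4)^n / n)(1 + O(1/n)). -/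
open Filter Asymptotics

/-- Wendel's upper bound, a consequence of the log-convexity of the Gamma function. -/
theorem Real.Gamma_add_le_Gamma_mul_rpow {x s : ℝ} (hx : 0 < x) (hs₀ : 0 < s) (hs₁ : s < 1) :
    Real.Gamma (x + s) ≤ Real.Gamma x * x ^ s := by
  have hΓ := Real.Gamma_pos_of_pos hx
  have h := Real.Gamma_mul_add_mul_le_rpow_Gamma_mul_rpow_Gamma hx (by linarith : 0 < x + 1)
    (sub_pos.2 hs₁) hs₀ (by ring)
  rw [Real.Gamma_add_one hx.ne', Real.mul_rpow hx.le hΓ.le] at h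
  calc Real.Gamma (x + s) = Real.Gamma ((1 - s) * x + s * (x + 1)) := by ring_nf
    _ ≤ Real.Gamma x ^ (1 - s) * (x ^ s * Real.Gamma x ^ s) := h
    _ = Real.Gamma x ^ (1 - s) * Real.Gamma x ^ s * x ^ s := by ring
    _ = Real.Gamma x * x ^ s := by rw [← Real.rpow_add hΓ, sub_add_cancel, Real.rpow_one]

theorem Real.Gamma_add_mul_Gamma_add_one_sub_le {x s : ℝ} (hx : 0 < x) (hs₀ : 0 < s)
    (hs₁ : s < 1) :
    Real.Gamma (x + s) * Real.Gamma (x + (1 - s)) ≤ x * Real.Gamma x ^ 2 := by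
  have hΓ := Real.Gamma_pos_of_pos hx
  calc Real.Gamma (x + s) * Real.Gamma (x + (1 - s))
      ≤ (Real.Gamma x * x ^ s) * (Real.Gamma x * x ^ (1 - s)) :=
        mul_le_mul (Real.Gamma_add_le_Gamma_mul_rpow hx hs₀ hs₁)
          (Real.Gamma_add_le_Gamma_mul_rpow hx (by linarith) (by linarith))
          (Real.Gamma_pos_of_pos (by linarith)).le (by positivity)
    _ = x ^ s * x ^ (1 - s) * Real.Gamma x ^ 2 := by ring
    _ = x * Real.Gamma x ^ 2 := by rw [← Real.rpow_add hx, add_sub_cancel, Real.rpow_one]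

theorem Real.Gamma_add_one_le_Gamma_add_mul_rpow {x s : ℝ} (hx : 0 < x) (hs₀ : 0 < s)
    (hs₁ : s < 1) :
    Real.Gamma (x + 1) ≤ Real.Gamma (x + s) * (x + 1) ^ (1 - s) := by
  have hxs : 0 < x + s := by linarith
  have hΓ := Real.Gamma_pos_of_pos hxs
  calc Real.Gamma (x + 1) = Real.Gamma (x + s + (1 - s)) := by ring_nf
    _ ≤ Real.Gamma (x + s) * (x + s) ^ (1 - s) :=
        Real.Gamma_add_le_Gamma_mul_rpow hxs (by linarith) (by linarith)
    _ ≤ Real.Gamma (x + s) * (x + 1) ^ (1 - s) :=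
        mul_le_mul_of_nonneg_left
          (Real.rpow_le_rpow hxs.le (by linarith) (by linarith)) hΓ.le

theorem Real.Gamma_add_one_sq_le {x s : ℝ} (hx : 0 < x) (hs₀ : 0 < s) (hs₁ : s < 1) :
    Real.Gamma (x + 1) ^ 2 ≤ (x + 1) * (Real.Gamma (x + s) * Real.Gamma (x + (1 - s))) := by
  have hΓ := Real.Gamma_pos_of_pos (by linarith : 0 < x + s)
  have hx₁ : 0 < x + 1 := by linarith
  calc Real.Gamma (x + 1) ^ 2 = Real.Gamma (x + 1) * Real.Gamma (x + 1) := sq _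
    _ ≤ (Real.Gamma (x + s) * (x + 1) ^ (1 - s)) *
          (Real.Gamma (x + (1 - s)) * (x + 1) ^ (1 - (1 - s))) :=
        mul_le_mul (Real.Gamma_add_one_le_Gamma_add_mul_rpow hx hs₀ hs₁)
          (Real.Gamma_add_one_le_Gamma_add_mul_rpow hx (by linarith) (by linarith))
          (Real.Gamma_pos_of_pos hx₁).le (by positivity)
    _ = (x + 1) ^ (1 - s) * (x + 1) ^ (1 - (1 - s)) *
          (Real.Gamma (x + s) * Real.Gamma (x + (1 - s))) := by ring
    _ = (x + 1) * (Real.Gamma (x + s) * Real.Gamma (x + (1 - s))) := by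
        rw [← Real.rpow_add hx₁, add_sub_cancel, Real.rpow_one]

theorem abs_mul_Gamma_mul_Gamma_div_sub_one_le {x : ℝ} (hx : 0 < x) :
    |x * Real.Gamma (x + 1 / 4) * Real.Gamma (x + 3 / 4) / Real.Gamma (x + 1) ^ 2 - 1| ≤
      1 / x := by
  have hup := Real.Gamma_add_mul_Gamma_add_one_sub_le (s := 1 / 4) hx (by norm_num) (by norm_num)
  have hlow := Real.Gamma_add_one_sq_le (s := 1 / 4) hx (by norm_num) (by norm_num)
  rw [show (1 - 1 / 4 : ℝ) = 3 / 4 by norm_num] at hup hlow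
  have hΓ : 0 < Real.Gamma (x + 1) ^ 2 := pow_pos (Real.Gamma_pos_of_pos (by linarith)) 2
  have hle : x * Real.Gamma (x + 1 / 4) * Real.Gamma (x + 3 / 4) / Real.Gamma (x + 1) ^ 2 ≤ 1 := by
    rw [div_le_one hΓ, Real.Gamma_add_one hx.ne']
    nlinarith
  have hge : x / (x + 1) ≤
      x * Real.Gamma (x + 1 / 4) * Real.Gamma (x + 3 / 4) / Real.Gamma (x + 1) ^ 2 := by
    rw [div_le_div_iff₀ (by linarith) hΓ]
    nlinarith
  have hx₁ : 1 - 1 / x ≤ x / (x + 1) := by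
    rw [one_sub_div hx.ne', div_le_div_iff₀ hx (by linarith)]
    nlinarith
  have hpos : 0 < 1 / x := by positivity
  exact abs_le.2 ⟨by linarith, by linarith⟩

/-- The Borel-transform coefficients `b_n = (−4)^n Γ(n+1/4)Γ(n+3/4)/Γ(n+1)²` of the
zero-dimensional `Φ⁴` partition function satisfy
`lim_{n→∞} n Γ(n+1/4)Γ(n+3/4)/Γ(n+1)² = 1`, i.e. `b_n = ((−4)^n/n)(1 + O(1/n))`. -/
theorem stmt8 :
    Tendsto
      (fun n : ℕ =>
        (n : ℝ) * Real.Gamma (n + 1 / 4) * Real.Gamma (n + 3 / 4) / Real.Gamma (n + 1) ^ 2)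
      atTop (nhds 1) ∧
    (fun n : ℕ =>
        (n : ℝ) * Real.Gamma (n + 1 / 4) * Real.Gamma (n + 3 / 4) / Real.Gamma (n + 1) ^ 2 - 1)
      =O[atTop] fun n : ℕ => 1 / (n : ℝ) := by
  have hO : (fun n : ℕ =>
        (n : ℝ) * Real.Gamma (n + 1 / 4) * Real.Gamma (n + 3 / 4) / Real.Gamma (n + 1) ^ 2 - 1)
      =O[atTop] fun n : ℕ => 1 / (n : ℝ) := by
    refine IsBigO.of_bound 1 ?_
    filter_upwards [eventually_gt_atTop 0] with n hn
    have hn' : (0 : ℝ) < n := Nat.cast_pos.2 hn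
    rw [one_mul, Real.norm_eq_abs, Real.norm_of_nonneg (by positivity)]
    exact abs_mul_Gamma_mul_Gamma_div_sub_one_le hn'
  exact ⟨tendsto_sub_nhds_zero_iff.1 (hO.trans_tendsto tendsto_one_div_atTop_nhds_zero_nat), hO⟩
end

section
/- There exists a constant C > 0 such that for every natural number N ≥ 2, the Fourier representation of the sunset counterterm satisfies ∑_{j, k ∈ 𝓚_N, j+k ∈ 𝓚_N} 1/((4π²‖j‖² + 1)(4π²‖k‖² + 1)(4π²‖j+k‖² + 1)) ≤ C · log N; this quantity equals ∫_{𝕋³} G_N(x)³ dx = C_N^{(2)}/3!, which is therefore O(log N). -/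
open MeasureTheory

/-- `energy k = 4π²‖k‖² + 1` for `k ∈ ℤ³`. -/
noncomputable def energy (k : ℤ × ℤ × ℤ) : ℝ :=
  4 * Real.pi ^ 2 * ((k.1 : ℝ) ^ 2 + (k.2.1 : ℝ) ^ 2 + (k.2.2 : ℝ) ^ 2) + 1

/-- The constrained lattice sum `∑_{j,k ∈ 𝓚_N, j+k ∈ 𝓚_N} 1/(energy j · energy k · energy (j+k))`,
where `𝓚_N = {k ∈ ℤ³ : |k₁|+|k₂|+|k₃| ≤ N}`. -/
noncomputable def sunsetSum (N : ℕ) : ℝ :=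
  ∑' p : (ℤ × ℤ × ℤ) × (ℤ × ℤ × ℤ),
    if |p.1.1| + |p.1.2.1| + |p.1.2.2| ≤ (N : ℤ) ∧ |p.2.1| + |p.2.2.1| + |p.2.2.2| ≤ (N : ℤ) ∧
        |(p.1 + p.2).1| + |(p.1 + p.2).2.1| + |(p.1 + p.2).2.2| ≤ (N : ℤ) then
      1 / (energy p.1 * energy p.2 * energy (p.1 + p.2))
    else 0

/-- The truncated Green function `G_N(x) = ∑_{k ∈ 𝓚_N} e^{2πi k·x}/(4π²‖k‖² + 1)` on the
torus `𝕋³ = (ℝ/ℤ)³`, viewed as a `ℤ³`-periodic function on `ℝ³`. -/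
noncomputable def greenFn (N : ℕ) (x : ℝ × ℝ × ℝ) : ℂ :=
  ∑' k : ℤ × ℤ × ℤ,
    if |k.1| + |k.2.1| + |k.2.2| ≤ (N : ℤ) then
      Complex.exp (2 * Real.pi * Complex.I *
        ((k.1 : ℂ) * (x.1 : ℂ) + (k.2.1 : ℂ) * (x.2.1 : ℂ) + (k.2.2 : ℂ) * (x.2.2 : ℂ))) /
        (energy k : ℂ)
    else 0

/-- The truncated frequency set `𝓚_N`, an `ℓ¹`-ball of `ℤ³`. -/
noncomputable def freqBall (N : ℕ) : Finset (ℤ × ℤ × ℤ) :=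
  (Finset.Icc (-(N : ℤ), -(N : ℤ), -(N : ℤ)) ((N : ℤ), (N : ℤ), (N : ℤ))).filter
    fun k => |k.1| + |k.2.1| + |k.2.2| ≤ (N : ℤ)

/-- The sup norm on `ℤ³`. -/
def supNorm (k : ℤ × ℤ × ℤ) : ℕ := max k.1.natAbs (max k.2.1.natAbs k.2.2.natAbs)

theorem mem_freqBall {N : ℕ} {k : ℤ × ℤ × ℤ} :
    k ∈ freqBall N ↔ |k.1| + |k.2.1| + |k.2.2| ≤ (N : ℤ) := by
  obtain ⟨a, b, c⟩ := k
  simp only [freqBall, Finset.mem_filter, Finset.mem_Icc, Prod.mk_le_mk, and_iff_right_iff_imp]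
  intro h
  grind

theorem neg_mem_freqBall {N : ℕ} {k : ℤ × ℤ × ℤ} : -k ∈ freqBall N ↔ k ∈ freqBall N := by
  simp [mem_freqBall]

theorem supNorm_le_of_mem_freqBall {N : ℕ} {k : ℤ × ℤ × ℤ} (hk : k ∈ freqBall N) :
    supNorm k ≤ N := by
  rw [mem_freqBall] at hk
  simp only [supNorm]
  grind

theorem supNorm_add_le (j k : ℤ × ℤ × ℤ) : supNorm (j + k) ≤ supNorm j + supNorm k := by
  have h1 := Int.natAbs_add_le j.1 k.1
  have h2 := Int.natAbs_add_le j.2.1 k.2.1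
  have h3 := Int.natAbs_add_le j.2.2 k.2.2
  simp only [supNorm, Prod.fst_add, Prod.snd_add, max_le_iff]
  refine ⟨h1.trans ?_, h2.trans ?_, h3.trans ?_⟩ <;> gcongr <;> simp

theorem supNorm_neg (k : ℤ × ℤ × ℤ) : supNorm (-k) = supNorm k := by
  simp [supNorm]

theorem energy_pos (k : ℤ × ℤ × ℤ) : 0 < energy k := by
  unfold energy; positivity

theorem energy_neg (k : ℤ × ℤ × ℤ) : energy (-k) = energy k := by
  simp [energy]

theorem sq_supNorm_add_one_le (k : ℤ × ℤ × ℤ) : ((supNorm k : ℝ) + 1) ^ 2 / 2 ≤ energy k := by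
  have hs : (supNorm k : ℝ) ^ 2 ≤ (k.1 : ℝ) ^ 2 + (k.2.1 : ℝ) ^ 2 + (k.2.2 : ℝ) ^ 2 := by
    have cast_sq (a : ℤ) : ((a.natAbs : ℕ) : ℝ) ^ 2 = (a : ℝ) ^ 2 := by
      rw [Nat.cast_natAbs, Int.cast_abs, sq_abs]
    rw [← cast_sq k.1, ← cast_sq k.2.1, ← cast_sq k.2.2]
    unfold supNorm
    rcases max_choice k.1.natAbs (max k.2.1.natAbs k.2.2.natAbs) with h | h
    · rw [h]; nlinarith
    · rw [h]
      rcases max_choice k.2.1.natAbs k.2.2.natAbs with h' | h' <;> rw [h'] <;> nlinarith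
  have hpi : 1 ≤ 4 * Real.pi ^ 2 := by nlinarith [Real.pi_gt_three]
  unfold energy
  nlinarith [sq_nonneg ((supNorm k : ℝ) - 1), mul_le_mul_of_nonneg_right hpi
    (by positivity : 0 ≤ (k.1 : ℝ) ^ 2 + (k.2.1 : ℝ) ^ 2 + (k.2.2 : ℝ) ^ 2)]

theorem card_filter_supNorm_eq_le (s : Finset (ℤ × ℤ × ℤ)) (m : ℕ) :
    (s.filter fun k => supNorm k = m).card ≤ 26 * (m + 1) ^ 2 := by
  calc (s.filter fun k => supNorm k = m).card
      ≤ (Finset.box m : Finset (ℤ × ℤ × ℤ)).card := by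
        refine Finset.card_le_card fun k hk => ?_
        obtain ⟨a, b, c⟩ := k
        have h := (Finset.mem_filter.1 hk).2
        simp only [supNorm] at h
        cases m with
        | zero =>
          simp only [Finset.box_zero, Finset.mem_singleton, Prod.ext_iff, Prod.fst_zero,
            Prod.snd_zero]
          omega
        | succ n =>
          simp only [Finset.box_succ_eq_sdiff, Finset.mem_sdiff, Finset.mem_Icc, Prod.le_def,
            Prod.fst_neg, Prod.snd_neg, Prod.fst_natCast, Prod.snd_natCast]
          push_cast
          omega
    _ ≤ 26 * (m + 1) ^ 2 := by
        cases m with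
        | zero => simp
        | succ n =>
          rw [Prod.card_box_succ]
          simp only [Finset.card_Icc_prod, Prod.fst_neg, Prod.snd_neg, Prod.fst_natCast,
            Prod.snd_natCast, Int.card_Icc]
          have h1 : (((n + 1 : ℕ) : ℤ) + 1 - -((n + 1 : ℕ) : ℤ)).toNat = 2 * n + 3 := by omega
          have h2 : ((n : ℤ) + 1 - -(n : ℤ)).toNat = 2 * n + 1 := by omega
          rw [h1, h2]
          refine Nat.sub_le_of_le_add ?_
          nlinarith

theorem sum_supNorm_le (N : ℕ) (φ : ℕ → ℝ) (hφ : ∀ m, 0 ≤ φ m) :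
    ∑ k ∈ freqBall N, φ (supNorm k) ≤
      ∑ m ∈ Finset.range (N + 1), 26 * ((m : ℝ) + 1) ^ 2 * φ m := by
  rw [← Finset.sum_fiberwise_of_maps_to (t := Finset.range (N + 1)) (g := supNorm)
    fun k hk => Finset.mem_range_succ_iff.2 (supNorm_le_of_mem_freqBall hk)]
  refine Finset.sum_le_sum fun m _ => ?_
  rw [Finset.sum_congr rfl fun k hk => by rw [(Finset.mem_filter.1 hk).2], Finset.sum_const,
    nsmul_eq_mul]
  exact mul_le_mul_of_nonneg_right
    (by exact_mod_cast card_filter_supNorm_eq_le (freqBall N) m) (hφ m)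

/-- Weight dominating the sunset summand when `a` is the shortest of the three momenta. -/
noncomputable def orderedWeight (a b : ℤ × ℤ × ℤ) : ℝ :=
  if supNorm a ≤ supNorm b then 1 / (((supNorm a : ℝ) + 1) ^ 2 * ((supNorm b : ℝ) + 1) ^ 4) else 0

theorem orderedWeight_nonneg (a b : ℤ × ℤ × ℤ) : 0 ≤ orderedWeight a b := by
  unfold orderedWeight; split_ifs <;> positivity

theorem sum_orderedWeight_left_le (N : ℕ) (b : ℤ × ℤ × ℤ) :
    ∑ a ∈ freqBall N, orderedWeight a b ≤ 26 * (1 / ((supNorm b : ℝ) + 1) ^ 3) := by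
  refine (sum_supNorm_le N (fun m => if m ≤ supNorm b then
    1 / (((m : ℝ) + 1) ^ 2 * ((supNorm b : ℝ) + 1) ^ 4) else 0)
    fun m => by split_ifs <;> positivity).trans ?_
  calc _ = ∑ m ∈ (Finset.range (N + 1)).filter (· ≤ supNorm b),
        26 * (1 / ((supNorm b : ℝ) + 1) ^ 4) := by
        rw [Finset.sum_filter]
        refine Finset.sum_congr rfl fun m _ => ?_
        split_ifs
        · field_simp
        · simp
    _ ≤ ((supNorm b : ℝ) + 1) * (26 * (1 / ((supNorm b : ℝ) + 1) ^ 4)) := by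
        rw [Finset.sum_const, nsmul_eq_mul]
        refine mul_le_mul_of_nonneg_right ?_ (by positivity)
        have : ((Finset.range (N + 1)).filter (· ≤ supNorm b)).card ≤ supNorm b + 1 := by
          rw [← Finset.card_range (supNorm b + 1)]
          exact Finset.card_le_card fun m hm =>
            Finset.mem_range_succ_iff.2 (Finset.mem_filter.1 hm).2
        exact_mod_cast this
    _ = 26 * (1 / ((supNorm b : ℝ) + 1) ^ 3) := by field_simp

theorem sum_one_div_succ_le_log {N : ℕ} (hN : 2 ≤ N) :
    ∑ m ∈ Finset.range (N + 1), 1 / ((m : ℝ) + 1) ≤ 4 * Real.log N := by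
  have hN' : (2 : ℝ) ≤ N := by exact_mod_cast hN
  have h := harmonic_le_one_add_log (N + 1)
  have hsum : ((harmonic (N + 1) : ℚ) : ℝ) = ∑ m ∈ Finset.range (N + 1), 1 / ((m : ℝ) + 1) := by
    simp [harmonic]
  rw [hsum] at h
  have hlog2 : Real.log 2 ≤ Real.log N := Real.log_le_log (by norm_num) hN'
  have hlog : Real.log ((N + 1 : ℕ) : ℝ) ≤ 2 * Real.log N := by
    have : Real.log ((N : ℝ) ^ 2) = 2 * Real.log N := by rw [Real.log_pow]; norm_num
    rw [← this]
    refine Real.log_le_log (by positivity) ?_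
    push_cast
    nlinarith
  linarith [Real.log_two_gt_d9]

theorem sum_orderedWeight_le {N : ℕ} (hN : 2 ≤ N) :
    ∑ b ∈ freqBall N, ∑ a ∈ freqBall N, orderedWeight a b ≤ 26 * 26 * 4 * Real.log N := by
  calc ∑ b ∈ freqBall N, ∑ a ∈ freqBall N, orderedWeight a b
      ≤ ∑ b ∈ freqBall N, 26 * (1 / ((supNorm b : ℝ) + 1) ^ 3) :=
        Finset.sum_le_sum fun b _ => sum_orderedWeight_left_le N b
    _ ≤ ∑ m ∈ Finset.range (N + 1),
          26 * ((m : ℝ) + 1) ^ 2 * (26 * (1 / ((m : ℝ) + 1) ^ 3)) :=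
        sum_supNorm_le N (fun m => 26 * (1 / ((m : ℝ) + 1) ^ 3)) fun m => by positivity
    _ = 26 * 26 * ∑ m ∈ Finset.range (N + 1), 1 / ((m : ℝ) + 1) := by
        rw [Finset.mul_sum]
        refine Finset.sum_congr rfl fun m _ => ?_
        field_simp
    _ ≤ 26 * 26 * 4 * Real.log N := by linarith [sum_one_div_succ_le_log hN]

/-- The hypotheses force `supNorm b ≤ 2 * supNorm c`, so `energy c` dominates the weight of `b`. -/
theorem one_div_energy_le_orderedWeight {a b c : ℤ × ℤ × ℤ} (hab : supNorm a ≤ supNorm b)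
    (hac : supNorm a ≤ supNorm c) (hbc : supNorm b ≤ supNorm a + supNorm c) :
    1 / (energy a * energy b * energy c) ≤ 32 * orderedWeight a b := by
  rw [orderedWeight, if_pos hab, mul_one_div]
  have ha := sq_supNorm_add_one_le a
  have hb := sq_supNorm_add_one_le b
  have hc : ((supNorm b : ℝ) + 1) ^ 2 / 8 ≤ energy c := by
    have h : (supNorm b : ℝ) ≤ 2 * supNorm c := by
      exact_mod_cast (by omega : supNorm b ≤ 2 * supNorm c)
    nlinarith [sq_supNorm_add_one_le c, (supNorm b).cast_nonneg (α := ℝ)]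
  have := energy_pos a
  have := energy_pos b
  calc 1 / (energy a * energy b * energy c)
      ≤ 1 / (((supNorm a : ℝ) + 1) ^ 2 / 2 * (((supNorm b : ℝ) + 1) ^ 2 / 2) *
          (((supNorm b : ℝ) + 1) ^ 2 / 8)) := by gcongr
    _ = 32 / (((supNorm a : ℝ) + 1) ^ 2 * ((supNorm b : ℝ) + 1) ^ 4) := by
        field_simp; norm_num

theorem one_div_energy_le_sum_orderedWeight (j k : ℤ × ℤ × ℤ) :
    1 / (energy j * energy k * energy (j + k)) ≤
      32 * (orderedWeight j k + orderedWeight k j + orderedWeight (j + k) k) := by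
  have hl := supNorm_add_le j k
  have hk : supNorm k ≤ supNorm (j + k) + supNorm j := by
    simpa [supNorm_neg] using supNorm_add_le (j + k) (-j)
  have hj : supNorm j ≤ supNorm (j + k) + supNorm k := by
    simpa [supNorm_neg] using supNorm_add_le (j + k) (-k)
  have h1 := orderedWeight_nonneg j k
  have h2 := orderedWeight_nonneg k j
  have h3 := orderedWeight_nonneg (j + k) k
  rcases le_total (supNorm j) (supNorm k) with hjk | hjk
  · rcases le_total (supNorm j) (supNorm (j + k)) with hjl | hjl
    · linarith [one_div_energy_le_orderedWeight hjk hjl (by omega)]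
    · have h := one_div_energy_le_orderedWeight (hjl.trans hjk) hjl hk
      rw [show energy (j + k) * energy k * energy j = energy j * energy k * energy (j + k) by ring]
        at h
      linarith
  · rcases le_total (supNorm k) (supNorm (j + k)) with hkl | hkl
    · have h := one_div_energy_le_orderedWeight hjk hkl (by omega)
      rw [mul_comm (energy k)] at h
      linarith
    · have h := one_div_energy_le_orderedWeight hkl (hkl.trans hjk) hk
      rw [show energy (j + k) * energy k * energy j = energy j * energy k * energy (j + k) by ring]
        at h
      linarith

theorem sunsetSum_eq_sum (N : ℕ) :
    sunsetSum N = ∑ j ∈ freqBall N, ∑ k ∈ freqBall N,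
      if j + k ∈ freqBall N then 1 / (energy j * energy k * energy (j + k)) else 0 := by
  unfold sunsetSum
  simp only [← mem_freqBall]
  rw [tsum_eq_sum (s := freqBall N ×ˢ freqBall N), Finset.sum_product]
  · refine Finset.sum_congr rfl fun j hj => Finset.sum_congr rfl fun k hk => ?_
    simp [hj, hk]
  · intro p hp
    rw [Finset.mem_product] at hp
    exact if_neg fun h => hp ⟨h.1, h.2.1⟩

theorem sum_ite_add_mem_le (N : ℕ) (k : ℤ × ℤ × ℤ) (f : ℤ × ℤ × ℤ → ℝ) (hf : ∀ l, 0 ≤ f l) :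
    ∑ j ∈ freqBall N, (if j + k ∈ freqBall N then f (j + k) else 0) ≤
      ∑ l ∈ freqBall N, f l := by
  rw [← Finset.sum_filter,
    ← Finset.sum_image (f := f) (g := (· + k)) fun a _ b _ h => add_right_cancel h]
  refine Finset.sum_le_sum_of_subset_of_nonneg (fun l hl => ?_) fun l _ _ => hf l
  obtain ⟨j, hj, rfl⟩ := Finset.mem_image.1 hl
  exact (Finset.mem_filter.1 hj).2

theorem sunsetSum_le {N : ℕ} (hN : 2 ≤ N) :
    sunsetSum N ≤ 32 * 3 * (26 * 26 * 4) * Real.log N := by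
  set B := ∑ b ∈ freqBall N, ∑ a ∈ freqBall N, orderedWeight a b with hB
  have hle : sunsetSum N ≤ ∑ j ∈ freqBall N, ∑ k ∈ freqBall N,
      32 * (orderedWeight j k + orderedWeight k j +
        if j + k ∈ freqBall N then orderedWeight (j + k) k else 0) := by
    rw [sunsetSum_eq_sum]
    refine Finset.sum_le_sum fun j _ => Finset.sum_le_sum fun k _ => ?_
    split_ifs
    · exact one_div_energy_le_sum_orderedWeight j k
    · linarith [orderedWeight_nonneg j k, orderedWeight_nonneg k j]
  simp only [← Finset.mul_sum, Finset.sum_add_distrib] at hle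
  have h1 : ∑ j ∈ freqBall N, ∑ k ∈ freqBall N, orderedWeight j k = B := Finset.sum_comm
  have h3 : ∑ j ∈ freqBall N, ∑ k ∈ freqBall N,
      (if j + k ∈ freqBall N then orderedWeight (j + k) k else 0) ≤ B := by
    rw [Finset.sum_comm]
    exact Finset.sum_le_sum fun k _ =>
      sum_ite_add_mem_le N k (orderedWeight · k) fun l => orderedWeight_nonneg l k
  rw [h1, ← hB] at hle
  linarith [sum_orderedWeight_le hN]

/-- The character `x ↦ e^{2πi k·x}`. -/
noncomputable def torusChar (k : ℤ × ℤ × ℤ) (x : ℝ × ℝ × ℝ) : ℂ :=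
  Complex.exp (2 * Real.pi * Complex.I *
    ((k.1 : ℂ) * (x.1 : ℂ) + (k.2.1 : ℂ) * (x.2.1 : ℂ) + (k.2.2 : ℂ) * (x.2.2 : ℂ)))

theorem torusChar_add (j k : ℤ × ℤ × ℤ) (x : ℝ × ℝ × ℝ) :
    torusChar (j + k) x = torusChar j x * torusChar k x := by
  simp only [torusChar, ← Complex.exp_add, Prod.fst_add, Prod.snd_add, Int.cast_add]
  ring_nf

theorem continuous_torusChar (k : ℤ × ℤ × ℤ) : Continuous (torusChar k) := by
  unfold torusChar; fun_prop

theorem setIntegral_exp_two_pi_mul_I (n : ℤ) :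
    ∫ x in Set.Icc (0 : ℝ) 1, Complex.exp (2 * Real.pi * Complex.I * ((n : ℂ) * (x : ℂ))) =
      if n = 0 then 1 else 0 := by
  rw [integral_Icc_eq_integral_Ioc, ← intervalIntegral.integral_of_le zero_le_one]
  split_ifs with h
  · simp [h]
  · have hc : 2 * Real.pi * Complex.I * (n : ℂ) ≠ 0 := by
      simp [h, Real.pi_ne_zero]
    simp only [← mul_assoc]
    rw [integral_exp_mul_complex hc]
    have : Complex.exp (2 * Real.pi * Complex.I * (n : ℂ) * ((1 : ℝ) : ℂ)) = 1 := by
      rw [← Complex.exp_int_mul_two_pi_mul_I n]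
      congr 1
      push_cast
      ring
    rw [this]
    simp

theorem setIntegral_torusChar (k : ℤ × ℤ × ℤ) :
    ∫ x in Set.Icc (0 : ℝ × ℝ × ℝ) 1, torusChar k x = if k = 0 then 1 else 0 := by
  have hset : Set.Icc (0 : ℝ × ℝ × ℝ) 1 =
      Set.Icc (0 : ℝ) 1 ×ˢ (Set.Icc (0 : ℝ) 1 ×ˢ Set.Icc (0 : ℝ) 1) := by
    rw [Set.Icc_prod_Icc, Set.Icc_prod_Icc]; rfl
  have hsplit (x : ℝ × ℝ × ℝ) : torusChar k x =
      Complex.exp (2 * Real.pi * Complex.I * ((k.1 : ℂ) * (x.1 : ℂ))) *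
        (Complex.exp (2 * Real.pi * Complex.I * ((k.2.1 : ℂ) * (x.2.1 : ℂ))) *
          Complex.exp (2 * Real.pi * Complex.I * ((k.2.2 : ℂ) * (x.2.2 : ℂ)))) := by
    simp only [torusChar, ← Complex.exp_add]
    ring_nf
  simp only [hset, hsplit]
  rw [Measure.volume_eq_prod, setIntegral_prod_mul
      (fun x : ℝ => Complex.exp (2 * Real.pi * Complex.I * ((k.1 : ℂ) * (x : ℂ))))
      (fun y : ℝ × ℝ => Complex.exp (2 * Real.pi * Complex.I * ((k.2.1 : ℂ) * (y.1 : ℂ))) *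
        Complex.exp (2 * Real.pi * Complex.I * ((k.2.2 : ℂ) * (y.2 : ℂ)))),
    Measure.volume_eq_prod, setIntegral_prod_mul
      (fun x : ℝ => Complex.exp (2 * Real.pi * Complex.I * ((k.2.1 : ℂ) * (x : ℂ))))
      (fun x : ℝ => Complex.exp (2 * Real.pi * Complex.I * ((k.2.2 : ℂ) * (x : ℂ)))),
    setIntegral_exp_two_pi_mul_I, setIntegral_exp_two_pi_mul_I, setIntegral_exp_two_pi_mul_I]
  obtain ⟨a, b, c⟩ := k
  by_cases ha : a = 0 <;> by_cases hb : b = 0 <;> by_cases hc : c = 0 <;> simp [ha, hb, hc]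

theorem greenFn_eq_sum (N : ℕ) (x : ℝ × ℝ × ℝ) :
    greenFn N x = ∑ k ∈ freqBall N, torusChar k x / (energy k : ℂ) := by
  unfold greenFn
  simp only [← mem_freqBall]
  rw [tsum_eq_sum (s := freqBall N) fun k hk => if_neg hk]
  exact Finset.sum_congr rfl fun k hk => if_pos hk

theorem greenFn_pow_three (N : ℕ) (x : ℝ × ℝ × ℝ) :
    greenFn N x ^ 3 = ∑ j ∈ freqBall N, ∑ k ∈ freqBall N, ∑ l ∈ freqBall N,
      (1 / ((energy j : ℂ) * energy k * energy l)) * torusChar (j + k + l) x := by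
  rw [pow_succ, pow_two, greenFn_eq_sum, Finset.sum_mul_sum]
  simp only [Finset.sum_mul, Finset.mul_sum]
  refine Finset.sum_congr rfl fun j _ => Finset.sum_congr rfl fun k _ =>
    Finset.sum_congr rfl fun l _ => ?_
  rw [torusChar_add, torusChar_add]
  ring

theorem setIntegral_greenFn_pow_three (N : ℕ) :
    ∫ x in Set.Icc (0 : ℝ × ℝ × ℝ) 1, greenFn N x ^ 3 = (sunsetSum N : ℂ) := by
  have hchar (c : ℂ) (k : ℤ × ℤ × ℤ) :
      IntegrableOn (fun x => c * torusChar k x) (Set.Icc (0 : ℝ × ℝ × ℝ) 1) :=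
    (continuous_const.mul (continuous_torusChar k)).continuousOn.integrableOn_compact isCompact_Icc
  simp only [greenFn_pow_three]
  rw [integral_finsetSum _ fun j _ => integrable_finsetSum _ fun k _ =>
    integrable_finsetSum _ fun l _ => hchar _ _, sunsetSum_eq_sum]
  push_cast
  refine Finset.sum_congr rfl fun j _ => ?_
  rw [integral_finsetSum _ fun k _ => integrable_finsetSum _ fun l _ => hchar _ _]
  refine Finset.sum_congr rfl fun k _ => ?_
  rw [integral_finsetSum _ fun l _ => hchar _ _]
  have hzero (l : ℤ × ℤ × ℤ) : j + k + l = 0 ↔ -(j + k) = l := neg_eq_iff_add_eq_zero.symm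
  simp only [integral_const_mul, setIntegral_torusChar, hzero, mul_ite, mul_one, mul_zero,
    Finset.sum_ite_eq, neg_mem_freqBall, energy_neg]
  split_ifs <;> simp

/-- There is `C > 0` such that for all `N ≥ 2` the sunset lattice sum is at most `C log N`;
this quantity equals `∫_{𝕋³} G_N(x)³ dx = C_N^{(2)}/3!`, which is therefore `O(log N)`. -/
theorem stmt17 :
    ∃ C > (0 : ℝ), ∀ N : ℕ, 2 ≤ N →
      sunsetSum N ≤ C * Real.log N ∧
      (∫ x in Set.Icc (0 : ℝ × ℝ × ℝ) 1, (greenFn N x) ^ 3) = (sunsetSum N : ℂ) := by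
  exact ⟨32 * 3 * (26 * 26 * 4), by norm_num, fun N hN =>
    ⟨sunsetSum_le hN, setIntegral_greenFn_pow_three N⟩⟩
end
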